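/- arXiv:2409.11246 — 6 statements merged into one kernel-verified Lean document; each statement's English description precedes it below -/
import Mathlib

section
/- Let G be a finite group, let C ⊆ G be a conjugacy class, and let S, T ⊆ C with S nonempty and T a proper subset of C. Then there exists g ∈ G such that |S^g \ T| ≥ |S|·(|C| − |T|)/|C| (as a real-number inequality: |S^g \ T|·|C| ≥ |S|·(|C| − |T|)). -/
open Finset Pointwise

/-- The conjugate `S^g = {g⁻¹ s g : s ∈ S}` of a finite subset `S` of a group. -/
def finConj {G : Type*} [Group G] [DecidableEq G] (S : Finset G) (g : G) : Finset G :=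
  S.image (fun s => g⁻¹ * s * g)

/-- `C` is a conjugacy class of the finite group `G`, i.e. `C = {h⁻¹ x h : h ∈ G}` for some `x`. -/
def IsConjClassF {G : Type*} [Group G] [Fintype G] [DecidableEq G] (C : Finset G) : Prop :=
  ∃ x : G, C = Finset.univ.image (fun h : G => h⁻¹ * x * h)

theorem card_conjugators_eq {G : Type*} [Group G] [Fintype G] [DecidableEq G] {C : Finset G}
    (hC : IsConjClassF C) :
    ∃ k : ℕ, ∀ s ∈ C, ∀ t ∈ C, #{g : G | g⁻¹ * s * g = t} = k := by
  obtain ⟨x, rfl⟩ := hC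
  refine ⟨#{g : G | g⁻¹ * x * g = x}, fun s hs t ht => ?_⟩
  obtain ⟨a, -, rfl⟩ := mem_image.1 hs
  obtain ⟨b, -, rfl⟩ := mem_image.1 ht
  refine card_equiv ((Equiv.mulLeft a).trans (Equiv.mulRight b⁻¹)) fun g => ?_
  simp only [mem_filter, mem_univ, true_and, Equiv.trans_apply, Equiv.coe_mulLeft,
    Equiv.coe_mulRight]
  constructor
  · intro h
    calc _ = b * (g⁻¹ * (a⁻¹ * x * a) * g) * b⁻¹ := by group
      _ = x := by rw [h]; group
  · intro h
    calc _ = b⁻¹ * ((a * g * b⁻¹)⁻¹ * x * (a * g * b⁻¹)) * b := by group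
      _ = _ := by rw [h]

theorem conj_mem_of_isConjClassF {G : Type*} [Group G] [Fintype G] [DecidableEq G] {C : Finset G}
    (hC : IsConjClassF C) {s : G} (hs : s ∈ C) (g : G) : g⁻¹ * s * g ∈ C := by
  obtain ⟨x, rfl⟩ := hC
  obtain ⟨a, -, rfl⟩ := mem_image.1 hs
  exact mem_image.2 ⟨a * g, mem_univ _, by group⟩

theorem card_finConj_sdiff {G : Type*} [Group G] [DecidableEq G] (S T : Finset G) (g : G) :
    #(finConj S g \ T) = #{s ∈ S | g⁻¹ * s * g ∉ T} := by
  rw [finConj, sdiff_eq_filter, filter_image]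
  exact card_image_of_injective _ fun a b h => by simpa using h

theorem sum_card_finConj_sdiff_mul_card {G : Type*} [Group G] [Fintype G] [DecidableEq G]
    {C : Finset G} (hC : IsConjClassF C) {S : Finset G} (hS : S ⊆ C) (T : Finset G) :
    ∑ g : G, #(finConj S g \ T) * #C = ∑ _g : G, #S * #(C \ T) := by
  obtain ⟨k, hk⟩ := card_conjugators_eq hC
  have count (s : G) (hs : s ∈ C) : #{g : G | g⁻¹ * s * g ∉ T} = #(C \ T) * k := by
    rw [card_eq_sum_card_fiberwise (f := fun g => g⁻¹ * s * g) (t := C \ T)]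
    · rw [← smul_eq_mul, ← sum_const]
      refine sum_congr rfl fun t ht => ?_
      rw [← hk s hs t (mem_sdiff.1 ht).1, filter_filter]
      congr 1
      ext g
      simp only [mem_filter, mem_univ, true_and, and_iff_right_iff_imp]
      rintro rfl
      exact (mem_sdiff.1 ht).2
    · intro g hg
      simp only [coe_filter, mem_univ, true_and, Set.mem_ofPred_eq] at hg
      exact mem_coe.2 (mem_sdiff.2 ⟨conj_mem_of_isConjClassF hC hs g, hg⟩)
  have total (s : G) (hs : s ∈ C) : Fintype.card G = #C * k := by
    rw [← card_univ, card_eq_sum_card_fiberwise (f := fun g => g⁻¹ * s * g) (t := C)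
      fun g _ => conj_mem_of_isConjClassF hC hs g, ← smul_eq_mul, ← sum_const]
    exact sum_congr rfl fun t ht => hk s hs t ht
  have key : ∑ g : G, #(finConj S g \ T) = #S * (#(C \ T) * k) := by
    simp_rw [card_finConj_sdiff]
    rw [← smul_eq_mul, ← sum_const, ← sum_congr rfl fun s hs => count s (hS hs)]
    exact sum_card_bipartiteAbove_eq_sum_card_bipartiteBelow fun g s => g⁻¹ * s * g ∉ T
  obtain ⟨x, rfl⟩ := id hC
  rw [← sum_mul, key, sum_const, card_univ,
    total (1⁻¹ * x * 1) (mem_image_of_mem _ (mem_univ 1)), smul_eq_mul]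
  ring

theorem stmt_1 {G : Type*} [Group G] [Fintype G] [DecidableEq G]
    (C : Finset G) (hC : IsConjClassF C) (S T : Finset G)
    (hS : S ⊆ C) (hSne : S.Nonempty) (hT : T ⊂ C) :
    ∃ g : G, ((finConj S g \ T).card : ℝ) * (C.card : ℝ) ≥
      (S.card : ℝ) * ((C.card : ℝ) - (T.card : ℝ)) := by
  obtain ⟨g, -, hg⟩ := exists_le_of_sum_le univ_nonempty
    (sum_card_finConj_sdiff_mul_card hC hS T).ge
  refine ⟨g, ?_⟩
  rw [← cast_card_sdiff hT.subset]
  exact_mod_cast hg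
end

section
/- Let G be a finite group and let C ⊆ G be a conjugacy class. Then for any subset S ⊆ C with |S| ≥ 2, there is a set H ⊆ G with |H| ≤ 6·|C|·log|S| / |S| such that the union of the conjugates S^h over h ∈ H equals C. -/
open Finset Pointwise

section ConjugateCover

variable {G : Type*} [Group G] [DecidableEq G] [Fintype G] {C S : Finset G}

theorem IsConjClassF.conj_mem (hC : IsConjClassF C) {s : G} (hs : s ∈ C) (g : G) :
    g⁻¹ * s * g ∈ C := by
  obtain ⟨x, rfl⟩ := hC
  simp only [mem_image, mem_univ, true_and] at hs ⊢
  obtain ⟨h, rfl⟩ := hs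
  exact ⟨h * g, by group⟩

theorem IsConjClassF.exists_conj_eq (hC : IsConjClassF C) {s u : G} (hs : s ∈ C) (hu : u ∈ C) :
    ∃ g : G, g⁻¹ * s * g = u := by
  obtain ⟨x, rfl⟩ := hC
  simp only [mem_image, mem_univ, true_and] at hs hu
  obtain ⟨h, rfl⟩ := hs
  obtain ⟨k, rfl⟩ := hu
  exact ⟨h⁻¹ * k, by group⟩

theorem IsConjClassF.finConj_subset (hC : IsConjClassF C) (hS : S ⊆ C) (g : G) :
    finConj S g ⊆ C := by
  intro u hu
  obtain ⟨s, hs, rfl⟩ := mem_image.1 hu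
  exact hC.conj_mem (hS hs) g

/-- The elements of `G` conjugating `s` to `u` form a fraction `1 / |C|` of the group. -/
theorem IsConjClassF.card_mul_card_conjugators (hC : IsConjClassF C) {s u : G}
    (hs : s ∈ C) (hu : u ∈ C) :
    #C * #{g : G | g⁻¹ * s * g = u} = Fintype.card G := by
  have h := card_eq_sum_card_fiberwise (s := (univ : Finset G)) (t := C)
    (f := fun g => g⁻¹ * s * g) (fun g _ => hC.conj_mem hs g)
  rw [← card_univ, h, ← smul_eq_mul, ← sum_const]
  refine sum_congr rfl fun v hv => ?_
  obtain ⟨a, rfl⟩ := hC.exists_conj_eq hu hv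
  refine card_bij (fun g _ => g * a) ?_ (fun _ _ _ _ h => mul_right_cancel h) ?_
  · intro g hg
    simp only [mem_filter, mem_univ, true_and] at hg ⊢
    rw [← hg]
    group
  · intro g hg
    simp only [mem_filter, mem_univ, true_and] at hg
    refine ⟨g * a⁻¹, ?_, by group⟩
    simp only [mem_filter, mem_univ, true_and]
    have h2 : a * (g⁻¹ * s * g) * a⁻¹ = u := by
      rw [hg]
      group
    rw [← h2]
    group

/-- By averaging, some conjugate of `S` meets `U` in at least the expected proportion. -/
theorem IsConjClassF.exists_card_inter_finConj (hC : IsConjClassF C) (hS : S ⊆ C)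
    {U : Finset G} (hU : U ⊆ C) :
    ∃ g : G, #S * #U ≤ #C * #(finConj S g ∩ U) := by
  have hcard (g : G) : #(finConj S g ∩ U) =
      ∑ s ∈ S, ∑ u ∈ U, if g⁻¹ * s * g = u then 1 else 0 := by
    have hinj : Set.InjOn (fun s => g⁻¹ * s * g) (S : Set G) := fun a _ b _ h => by
      simpa using h
    rw [← filter_mem_eq_inter, card_filter, finConj, sum_image hinj]
    exact sum_congr rfl fun s _ => by simp
  have hsum : ∑ g : G, #C * #(finConj S g ∩ U) = ∑ _g : G, #S * #U := by
    calc ∑ g : G, #C * #(finConj S g ∩ U)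
        = ∑ s ∈ S, ∑ u ∈ U, #C * #{g : G | g⁻¹ * s * g = u} := by
          simp_rw [hcard, card_filter, mul_sum]
          rw [sum_comm]
          exact sum_congr rfl fun s _ => sum_comm
      _ = ∑ s ∈ S, ∑ u ∈ U, Fintype.card G :=
          sum_congr rfl fun s hs => sum_congr rfl fun u hu =>
            hC.card_mul_card_conjugators (hS hs) (hU hu)
      _ = ∑ _g : G, #S * #U := by
          simp only [sum_const, smul_eq_mul, card_univ]
          ring
  obtain ⟨g, -, hg⟩ := exists_le_of_sum_le univ_nonempty hsum.ge
  exact ⟨g, hg⟩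

/-- Greedily chosen conjugates shrink the uncovered part of the class geometrically. -/
theorem IsConjClassF.exists_card_sdiff_biUnion_le (hC : IsConjClassF C) (hS : S ⊆ C)
    (hne : S.Nonempty) (k : ℕ) :
    ∃ H : Finset G, #H ≤ k ∧
      (#(C \ H.biUnion (finConj S)) : ℝ) ≤ #C * (1 - #S / #C : ℝ) ^ k := by
  have hc : (0 : ℝ) < #C := by exact_mod_cast (hne.mono hS).card_pos
  have hsc : (#S : ℝ) ≤ #C := by exact_mod_cast card_le_card hS
  induction k with
  | zero => exact ⟨∅, by simp⟩
  | succ k ih =>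
    obtain ⟨H, hH, hle⟩ := ih
    set U := C \ H.biUnion (finConj S) with hUdef
    obtain ⟨g, hg⟩ := hC.exists_card_inter_finConj hS (U := U) sdiff_subset
    refine ⟨insert g H, (card_insert_le _ _).trans (by omega), ?_⟩
    have hrem : C \ (insert g H).biUnion (finConj S) = U \ finConj S g := by
      rw [biUnion_insert, hUdef, sdiff_sdiff_left, sup_eq_union, union_comm]
    have hcard : (#(U \ finConj S g) : ℝ) = #U - #(finConj S g ∩ U) := by
      rw [card_sdiff, Nat.cast_sub (card_le_card inter_subset_right)]
    have hg' : (#S * #U : ℝ) ≤ #C * #(finConj S g ∩ U) := by exact_mod_cast hg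
    have h1 : (#S / #C : ℝ) * #U ≤ #(finConj S g ∩ U) := by
      rw [div_mul_eq_mul_div, div_le_iff₀ hc]
      linarith
    have h2 : (0 : ℝ) ≤ 1 - #S / #C := by
      rw [sub_nonneg]
      exact (div_le_one hc).2 hsc
    rw [hrem, hcard, pow_succ]
    nlinarith [mul_le_mul_of_nonneg_right hle h2]

/-- Any part of the class is covered by at most as many conjugates of `S` as it has elements. -/
theorem IsConjClassF.exists_cover_card_le (hC : IsConjClassF C) (hS : S ⊆ C)
    (hne : S.Nonempty) {U : Finset G} (hU : U ⊆ C) :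
    ∃ H : Finset G, #H ≤ #U ∧ U ⊆ H.biUnion (finConj S) := by
  obtain ⟨s, hs⟩ := hne
  choose! f hf using fun u (hu : u ∈ C) => hC.exists_conj_eq (hS hs) hu
  refine ⟨U.image f, card_image_le, fun u hu => ?_⟩
  exact mem_biUnion.2 ⟨f u, mem_image_of_mem f hu, mem_image.2 ⟨s, hs, hf u (hU hu)⟩⟩

end ConjugateCover

theorem stmt_2 {G : Type*} [Group G] [Fintype G] [DecidableEq G]
    (C : Finset G) (hC : IsConjClassF C) (S : Finset G) (hS : S ⊆ C) (hScard : 2 ≤ S.card) :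
    ∃ H : Finset G,
      (H.card : ℝ) ≤ 6 * (C.card : ℝ) * Real.log (S.card : ℝ) / (S.card : ℝ) ∧
      H.biUnion (fun h => finConj S h) = C := by
  have hne : S.Nonempty := card_pos.1 (by omega)
  have hs2 : (2 : ℝ) ≤ #S := by exact_mod_cast hScard
  have hs : (0 : ℝ) < #S := by linarith
  have hsc : (#S : ℝ) ≤ #C := by exact_mod_cast card_le_card hS
  have hc : (0 : ℝ) < #C := hs.trans_le hsc
  have hlog : 0.69 < Real.log #S :=
    lt_of_lt_of_le (by linarith [Real.log_two_gt_d9]) (Real.log_le_log (by norm_num) hs2)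
  set t : ℝ := #C / #S with ht
  have ht1 : 1 ≤ t := (one_le_div hs).2 hsc
  obtain ⟨H₁, hH₁, hle⟩ := hC.exists_card_sdiff_biUnion_le hS hne ⌈t * Real.log #S⌉₊
  obtain ⟨H₂, hH₂, hcov⟩ := hC.exists_cover_card_le hS hne
    (sdiff_subset : C \ H₁.biUnion (finConj S) ⊆ C)
  refine ⟨H₁ ∪ H₂, ?_, ?_⟩
  · have hk : (#H₁ : ℝ) ≤ t * Real.log #S + 1 :=
      (Nat.cast_le.2 hH₁).trans (Nat.ceil_lt_add_one (by positivity)).le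
    have hexp : (1 - #S / #C : ℝ) ^ ⌈t * Real.log #S⌉₊ ≤ (#S : ℝ)⁻¹ := by
      calc (1 - #S / #C : ℝ) ^ ⌈t * Real.log #S⌉₊
          ≤ Real.exp (-(#S / #C)) ^ ⌈t * Real.log #S⌉₊ :=
            pow_le_pow_left₀ (sub_nonneg.2 ((div_le_one hc).2 hsc))
              (Real.one_sub_le_exp_neg _) _
        _ = Real.exp (⌈t * Real.log #S⌉₊ * -(#S / #C)) := (Real.exp_nat_mul _ _).symm
        _ ≤ Real.exp (-Real.log #S) := by
            refine Real.exp_le_exp.2 ?_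
            have h := mul_le_mul_of_nonneg_right (Nat.le_ceil (t * Real.log #S))
              (show (0 : ℝ) ≤ #S / #C by positivity)
            have h' : t * Real.log #S * (#S / #C) = Real.log #S := by
              rw [ht]
              field_simp
            linarith
        _ = (#S : ℝ)⁻¹ := by rw [Real.exp_neg, Real.exp_log hs]
    have hrem : (#H₂ : ℝ) ≤ t :=
      calc (#H₂ : ℝ) ≤ #(C \ H₁.biUnion (finConj S)) := Nat.cast_le.2 hH₂
        _ ≤ #C * (#S : ℝ)⁻¹ := hle.trans (mul_le_mul_of_nonneg_left hexp hc.le)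
        _ = t := (div_eq_mul_inv _ _).symm
    have hunion : (#(H₁ ∪ H₂) : ℝ) ≤ #H₁ + #H₂ := by exact_mod_cast card_union_le _ _
    have hgoal : 6 * (#C : ℝ) * Real.log #S / #S = 6 * (t * Real.log #S) := by
      rw [ht]
      ring
    rw [hgoal]
    nlinarith
  · refine Subset.antisymm (biUnion_subset.2 fun g _ => hC.finConj_subset hS g) ?_
    rw [union_biUnion]
    exact sdiff_le_iff.1 hcov
end

section
/- Let G be a finite group, let C ⊆ G be a conjugacy class, and let Z₁, Z₂ ⊆ C. Then the number of elements g ∈ G for which Z₁ ∩ Z₂^g ≠ ∅ is at most |G|·|Z₁|·|Z₂| / |C|; equivalently, |{g ∈ G : Z₁ ∩ Z₂^g ≠ ∅}| · |C| ≤ |G| · |Z₁| · |Z₂|. -/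
open Finset Pointwise

/-- Any two elements of a conjugacy class are conjugate, in the convention `h⁻¹ x h`. -/
theorem IsConjClassF.exists_conj_eq_s6 {G : Type*} [Group G] [Fintype G] [DecidableEq G]
    {C : Finset G} (hC : IsConjClassF C) {a c : G} (ha : a ∈ C) (hc : c ∈ C) :
    ∃ k : G, k⁻¹ * a * k = c := by
  obtain ⟨x, rfl⟩ := hC
  obtain ⟨h, -, rfl⟩ := Finset.mem_image.1 ha
  obtain ⟨l, -, rfl⟩ := Finset.mem_image.1 hc
  exact ⟨h⁻¹ * l, by group⟩

/-- At most `|G| / |C|` elements of `G` conjugate `b` to a given element of the class `C`. -/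
theorem IsConjClassF.card_conj_eq_mul_card_le {G : Type*} [Group G] [Fintype G] [DecidableEq G]
    {C : Finset G} (hC : IsConjClassF C) {a : G} (ha : a ∈ C) (b : G) :
    (Finset.univ.filter (fun g : G => g⁻¹ * b * g = a)).card * C.card ≤ Fintype.card G := by
  have hex : ∀ c : G, ∃ k : G, c ∈ C → k⁻¹ * a * k = c := fun c => by
    by_cases hc : c ∈ C
    · obtain ⟨k, hk⟩ := hC.exists_conj_eq_s6 ha hc
      exact ⟨k, fun _ => hk⟩
    · exact ⟨1, fun h => absurd h hc⟩
  choose k hk using hex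
  rw [← Finset.card_product, ← Finset.card_univ]
  refine Finset.card_le_card_of_injOn (fun p => p.1 * k p.2)
    (fun _ _ => Finset.mem_coe.2 (Finset.mem_univ _)) ?_
  have key : ∀ g c : G, g⁻¹ * b * g = a → c ∈ C → (g * k c)⁻¹ * b * (g * k c) = c := by
    intro g c hg hc
    calc (g * k c)⁻¹ * b * (g * k c) = (k c)⁻¹ * (g⁻¹ * b * g) * k c := by group
      _ = c := by rw [hg, hk c hc]
  rintro ⟨g, c⟩ hp ⟨g', c'⟩ hp' heq
  simp only [Finset.coe_product, Set.mem_prod, Finset.mem_coe, Finset.mem_filter,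
    Finset.mem_univ, true_and] at hp hp' heq
  have hcc : c = c' := by
    rw [← key g c hp.1 hp.2, heq, key g' c' hp'.1 hp'.2]
  subst hcc
  rw [mul_right_cancel heq]

theorem stmt_6 {G : Type*} [Group G] [Fintype G] [DecidableEq G]
    (C : Finset G) (hC : IsConjClassF C) (Z₁ Z₂ : Finset G) (hZ₁ : Z₁ ⊆ C) (hZ₂ : Z₂ ⊆ C) :
    (Finset.univ.filter (fun g : G => (Z₁ ∩ finConj Z₂ g).Nonempty)).card * C.card ≤
      Fintype.card G * Z₁.card * Z₂.card := by
  have hsub : Finset.univ.filter (fun g : G => (Z₁ ∩ finConj Z₂ g).Nonempty) ⊆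
      (Z₁ ×ˢ Z₂).biUnion
        (fun p => Finset.univ.filter (fun g : G => g⁻¹ * p.2 * g = p.1)) := by
    intro g hg
    obtain ⟨a, ha⟩ := (Finset.mem_filter.1 hg).2
    obtain ⟨ha₁, ha₂⟩ := Finset.mem_inter.1 ha
    obtain ⟨b, hb, hba⟩ := Finset.mem_image.1 ha₂
    exact Finset.mem_biUnion.2
      ⟨(a, b), Finset.mem_product.2 ⟨ha₁, hb⟩, Finset.mem_filter.2 ⟨Finset.mem_univ _, hba⟩⟩
  calc _ ≤ (∑ p ∈ Z₁ ×ˢ Z₂,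
          (Finset.univ.filter (fun g : G => g⁻¹ * p.2 * g = p.1)).card) * C.card :=
        Nat.mul_le_mul_right _ ((Finset.card_le_card hsub).trans Finset.card_biUnion_le)
    _ ≤ ∑ _p ∈ Z₁ ×ˢ Z₂, Fintype.card G := by
        rw [Finset.sum_mul]
        exact Finset.sum_le_sum fun p hp =>
          hC.card_conj_eq_mul_card_le (hZ₁ (Finset.mem_product.1 hp).1) p.2
    _ = Fintype.card G * Z₁.card * Z₂.card := by
        rw [Finset.sum_const, Finset.card_product, smul_eq_mul]
        ring
end

section
/- Let G be a finite group and let S, T ⊆ G be subsets with e ∉ T and T = T⁻¹ (T symmetric and not containing the identity). Then there is a subset U ⊆ S with |U| ≥ |S| / (|T| + 1) (as a real-number or rational inequality: |U|·(|T|+1) ≥ |S|) such that U⁻¹U ∩ T = ∅. -/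
open Finset Pointwise

theorem stmt_7 {G : Type*} [Group G] [Fintype G] [DecidableEq G]
    (S T : Finset G) (hT1 : (1 : G) ∉ T) (hTsymm : T⁻¹ = T) :
    ∃ U : Finset G, U ⊆ S ∧ S.card ≤ U.card * (T.card + 1) ∧ (U⁻¹ * U) ∩ T = ∅ := by
  have hinv : ∀ t, t⁻¹ ∈ T → t ∈ T := fun t ht => by
    rwa [← hTsymm, Finset.mem_inv']
  obtain ⟨U, hU, hmax⟩ := Finset.exists_max_image
    (S.powerset.filter fun U => ∀ a ∈ U, ∀ b ∈ U, a⁻¹ * b ∉ T) Finset.card ⟨∅, by simp⟩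
  simp only [mem_filter, mem_powerset] at hU hmax
  obtain ⟨hUS, hUT⟩ := hU
  refine ⟨U, hUS, ?_, ?_⟩
  · have hcover : S ⊆ U * insert 1 T := by
      intro s hs
      by_contra hsU
      have hs_not_mem : s ∉ U := fun h =>
        hsU (by simpa using mul_mem_mul h (mem_insert_self 1 T))
      have hs_left : ∀ u ∈ U, u⁻¹ * s ∉ T := fun u hu h =>
        hsU (by simpa using mul_mem_mul hu (mem_insert_of_mem (b := 1) h))
      have hs_right : ∀ u ∈ U, s⁻¹ * u ∉ T := fun u hu h =>
        hs_left u hu (hinv _ (by simpa using h))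
      have hcard := hmax (insert s U) ⟨insert_subset hs hUS, by
        intro a ha b hb
        obtain rfl | haU := mem_insert.1 ha <;> obtain rfl | hbU := mem_insert.1 hb
        · simpa using hT1
        · exact hs_right b hbU
        · exact hs_left a haU
        · exact hUT a haU b hbU⟩
      rw [card_insert_of_notMem hs_not_mem] at hcard
      omega
    calc S.card ≤ (U * insert 1 T).card := card_le_card hcover
      _ ≤ U.card * (insert 1 T).card := card_mul_le
      _ = U.card * (T.card + 1) := by rw [card_insert_of_notMem hT1]
  · refine eq_empty_of_forall_notMem fun x hx => ?_
    obtain ⟨hxU, hxT⟩ := mem_inter.1 hx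
    obtain ⟨a, ha, b, hb, rfl⟩ := mem_mul.1 hxU
    exact hUT a⁻¹ (Finset.mem_inv'.1 ha) b hb (by simpa using hxT)
end

section
/- Let G be a finite group and let k be the number of nontrivial conjugacy classes of G (conjugacy classes different from {e}). Let X ⊆ G be a nonempty subset such that for every nontrivial conjugacy class C of G one has 2·k·|X⁻¹X ∩ C|·|XX⁻¹ ∩ C| < |C| (in particular this holds when X⁻¹X ∩ C = ∅). Then there exists g ∈ G with X⁻¹X ∩ (XX⁻¹)^g ⊆ {e}, and hence |X · X^g| = |X|². -/
open Finset Pointwise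

/-- Conjugating `b` onto a fixed element of a conjugacy class `C` can be done in at most `|G| / |C|`
ways. -/
theorem card_conjugators_mul_card_le {G : Type*} [Group G] [Fintype G] [DecidableEq G]
    {C : Finset G} (hC : IsConjClassF C) {a b : G} (ha : a ∈ C) (hb : b ∈ C) :
    (univ.filter (fun g : G => g⁻¹ * b * g = a)).card * C.card ≤ Fintype.card G := by
  obtain ⟨x, rfl⟩ := hC
  simp only [mem_image, mem_univ, true_and] at ha hb
  obtain ⟨s, rfl⟩ := ha
  obtain ⟨r, rfl⟩ := hb
  set C := univ.image (fun h : G => h⁻¹ * x * h)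
  have hmaps : ∀ g ∈ (univ : Finset G), g⁻¹ * (r⁻¹ * x * r) * g ∈ C := fun g _ =>
    mem_image.2 ⟨r * g, mem_univ _, by group⟩
  rw [← card_univ, card_eq_sum_card_fiberwise hmaps, mul_comm, ← smul_eq_mul]
  refine card_nsmul_le_sum _ _ _ fun c hc => ?_
  obtain ⟨t, -, rfl⟩ := mem_image.1 hc
  refine card_le_card_of_injOn (fun g => g * (s⁻¹ * t)) (fun g hg => ?_)
    (mul_left_injective _).injOn
  simp only [coe_filter, mem_univ, true_and, Set.mem_ofPred_eq] at hg ⊢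
  calc _ = (s⁻¹ * t)⁻¹ * (g⁻¹ * (r⁻¹ * x * r) * g) * (s⁻¹ * t) := by group
    _ = _ := by rw [hg]; group

/-- The number of `g` for which `A ∩ C` and the conjugate of `B ∩ C` by `g` meet. -/
theorem card_filter_exists_conj_mul_card_le {G : Type*} [Group G] [Fintype G] [DecidableEq G]
    {C : Finset G} (hC : IsConjClassF C) (A B : Finset G) :
    (univ.filter (fun g : G => ∃ a ∈ A ∩ C, ∃ b ∈ B ∩ C, g⁻¹ * b * g = a)).card * C.card ≤
      (A ∩ C).card * (B ∩ C).card * Fintype.card G := by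
  have hsub : univ.filter (fun g : G => ∃ a ∈ A ∩ C, ∃ b ∈ B ∩ C, g⁻¹ * b * g = a) ⊆
      ((A ∩ C) ×ˢ (B ∩ C)).biUnion
        (fun p => univ.filter (fun g : G => g⁻¹ * p.2 * g = p.1)) := by
    intro g hg
    obtain ⟨a, ha, b, hb, h⟩ := (mem_filter.1 hg).2
    exact mem_biUnion.2 ⟨(a, b), mem_product.2 ⟨ha, hb⟩, mem_filter.2 ⟨mem_univ _, h⟩⟩
  calc _ ≤ (∑ p ∈ (A ∩ C) ×ˢ (B ∩ C),
        (univ.filter (fun g : G => g⁻¹ * p.2 * g = p.1)).card) * C.card :=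
        Nat.mul_le_mul_right _ ((card_le_card hsub).trans card_biUnion_le)
    _ = ∑ p ∈ (A ∩ C) ×ˢ (B ∩ C),
        (univ.filter (fun g : G => g⁻¹ * p.2 * g = p.1)).card * C.card := sum_mul ..
    _ ≤ ((A ∩ C) ×ˢ (B ∩ C)).card • Fintype.card G := sum_le_card_nsmul _ _ _ fun p hp => by
        obtain ⟨h₁, h₂⟩ := mem_product.1 hp
        exact card_conjugators_mul_card_le hC (mem_inter.1 h₁).2 (mem_inter.1 h₂).2
    _ = _ := by rw [card_product, smul_eq_mul]

theorem card_mul_finConj_eq_sq {G : Type*} [Group G] [DecidableEq G] {X : Finset G} {g : G}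
    (hg : (X⁻¹ * X) ∩ finConj (X * X⁻¹) g ⊆ {1}) : (X * finConj X g).card = X.card ^ 2 := by
  have hcard : (finConj X g).card = X.card :=
    card_image_of_injective _ fun a b h => by simpa using h
  suffices h : (X * finConj X g).card = X.card * (finConj X g).card by rw [h, hcard, sq]
  refine card_mul_iff.2 ?_
  rintro ⟨x, u⟩ ⟨hx, hu⟩ ⟨x', u'⟩ ⟨hx', hu'⟩ h
  obtain ⟨y, hy, rfl⟩ := mem_image.1 (mem_coe.1 hu)
  obtain ⟨y', hy', rfl⟩ := mem_image.1 (mem_coe.1 hu')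
  dsimp only at h hx hx' hu hu'
  have key : x'⁻¹ * x = g⁻¹ * (y' * y⁻¹) * g := by
    rw [inv_mul_eq_iff_eq_mul]
    calc x = x * (g⁻¹ * y * g) * (g⁻¹ * y * g)⁻¹ := by group
      _ = _ := by rw [h]; group
  have hmem := hg (mem_inter.2 ⟨mul_mem_mul (inv_mem_inv hx') hx,
    mem_image.2 ⟨_, mul_mem_mul hy' (inv_mem_inv hy), key.symm⟩⟩)
  obtain rfl : x' = x := inv_mul_eq_one.1 (mem_singleton.1 hmem)
  exact Prod.ext rfl (mul_left_cancel h)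

theorem stmt_9 {G : Type*} [Group G] [Fintype G] [DecidableEq G]
    (k : ℕ)
    (hk : k = ((Finset.univ.image (fun x : G => Finset.univ.image (fun h : G => h⁻¹ * x * h))).filter
      (fun C => C ≠ ({1} : Finset G))).card)
    (X : Finset G) (hX : X.Nonempty)
    (hsmall : ∀ C : Finset G, IsConjClassF C → C ≠ ({1} : Finset G) →
      2 * k * ((X⁻¹ * X) ∩ C).card * ((X * X⁻¹) ∩ C).card < C.card) :
    ∃ g : G, (X⁻¹ * X) ∩ finConj (X * X⁻¹) g ⊆ {1} ∧
      (X * finConj X g).card = X.card ^ 2 := by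
  suffices h : ∃ g : G, (X⁻¹ * X) ∩ finConj (X * X⁻¹) g ⊆ {1} by
    obtain ⟨g, hg⟩ := h
    exact ⟨g, hg, card_mul_finConj_eq_sq hg⟩
  by_contra! hbad
  set K := (univ.image (fun x : G => univ.image (fun h : G => h⁻¹ * x * h))).filter
    (fun C => C ≠ ({1} : Finset G))
  set A := X⁻¹ * X
  set B := X * X⁻¹
  let N : Finset G → Finset G := fun C =>
    univ.filter (fun g : G => ∃ a ∈ A ∩ C, ∃ b ∈ B ∩ C, g⁻¹ * b * g = a)
  have hcover : (univ : Finset G) ⊆ K.biUnion N := by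
    intro g _
    obtain ⟨a, ha, ha1⟩ := not_subset.1 (hbad g)
    obtain ⟨haA, haB⟩ := mem_inter.1 ha
    obtain ⟨b, hb, hba⟩ := mem_image.1 haB
    have haC : a ∈ univ.image (fun h : G => h⁻¹ * b * h) := mem_image.2 ⟨g, mem_univ _, hba⟩
    have hbC : b ∈ univ.image (fun h : G => h⁻¹ * b * h) :=
      mem_image.2 ⟨1, mem_univ _, by simp⟩
    refine mem_biUnion.2 ⟨_, mem_filter.2 ⟨mem_image_of_mem _ (mem_univ b), fun h => ?_⟩,
      mem_filter.2 ⟨mem_univ _, a, mem_inter.2 ⟨haA, haC⟩, b, mem_inter.2 ⟨hb, hbC⟩, hba⟩⟩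
    exact ha1 (h ▸ haC)
  have hN : ∀ C ∈ K, 2 * k * (N C).card ≤ Fintype.card G := by
    intro C hCK
    obtain ⟨hC, hC1⟩ := mem_filter.1 hCK
    obtain ⟨x, -, rfl⟩ := mem_image.1 hC
    have hC : IsConjClassF (univ.image (fun h : G => h⁻¹ * x * h)) := ⟨x, rfl⟩
    set C := univ.image (fun h : G => h⁻¹ * x * h)
    have hlt := hsmall C hC hC1
    refine Nat.le_of_mul_le_mul_right ?_ (Nat.zero_lt_of_lt hlt)
    calc 2 * k * (N C).card * C.card = 2 * k * ((N C).card * C.card) := by ring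
      _ ≤ 2 * k * ((A ∩ C).card * (B ∩ C).card * Fintype.card G) :=
        Nat.mul_le_mul_left _ (card_filter_exists_conj_mul_card_le hC A B)
      _ = 2 * k * (A ∩ C).card * (B ∩ C).card * Fintype.card G := by ring
      _ ≤ C.card * Fintype.card G := Nat.mul_le_mul_right _ hlt.le
      _ = _ := mul_comm ..
  have hG : 0 < Fintype.card G := Fintype.card_pos
  have hsum : Fintype.card G ≤ ∑ C ∈ K, (N C).card :=
    (card_le_card hcover).trans card_biUnion_le
  have hk0 : 0 < k := by
    rw [hk, card_pos, nonempty_iff_ne_empty]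
    intro h
    rw [h, sum_empty] at hsum
    omega
  have hfinal : 2 * k * Fintype.card G ≤ k * Fintype.card G :=
    calc _ ≤ 2 * k * ∑ C ∈ K, (N C).card := Nat.mul_le_mul_left _ hsum
      _ = ∑ C ∈ K, 2 * k * (N C).card := mul_sum ..
      _ ≤ K.card • Fintype.card G := sum_le_card_nsmul _ _ _ hN
      _ = _ := by rw [hk, smul_eq_mul]
  nlinarith [Nat.mul_pos hk0 hG]
end

section
/- Let τ > 0 be a real number, let b be a positive integer, and let G be a finite nontrivial group with the following property: for every subset S ⊆ G with |S| ≥ 2, either there is g ∈ G with |S · S^g| ≥ |S|^{1+τ}, or G is the product of at most b conjugates of S. Then for every real 0 < c ≤ 1 and every subset Y ⊆ G with |Y| ≥ 2 and |Y| ≥ |G|^c, the group G is the product of at most 2^{⌈log(1/c)/log(1+τ)⌉} · b conjugates of Y. -/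
open Finset Pointwise

/-- `G` is the product of at most `N` conjugates of `S`: there are `n ≤ N` (with `n ≥ 1`) and
elements `g₁, …, gₙ` such that the pointwise product `S^{g₁} ⋯ S^{gₙ}` equals all of `G`. -/
def IsProdOfConj {G : Type*} [Group G] [Fintype G] [DecidableEq G]
    (S : Finset G) (N : ℕ) : Prop :=
  ∃ n : ℕ, 0 < n ∧ n ≤ N ∧ ∃ g : Fin n → G,
    (List.ofFn (fun i => finConj S (g i))).prod = (Finset.univ : Finset G)

theorem finConj_mul_finConj {G : Type*} [Group G] [DecidableEq G] (S : Finset G) (g h : G) :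
    finConj (S * finConj S g) h = finConj S h * finConj S (g * h) := by
  ext x
  simp only [finConj, Finset.mem_image, Finset.mem_mul]
  constructor
  · rintro ⟨_, ⟨s, hs, _, ⟨t, ht, rfl⟩, rfl⟩, rfl⟩
    exact ⟨_, ⟨s, hs, rfl⟩, _, ⟨t, ht, rfl⟩, by group⟩
  · rintro ⟨_, ⟨s, hs, rfl⟩, _, ⟨t, ht, rfl⟩, rfl⟩
    exact ⟨_, ⟨s, hs, _, ⟨t, ht, rfl⟩, rfl⟩, by group⟩

theorem isProdOfConj_iff_exists_list {G : Type*} [Group G] [Fintype G] [DecidableEq G]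
    {S : Finset G} {N : ℕ} :
    IsProdOfConj S N ↔ ∃ l : List G, 0 < l.length ∧ l.length ≤ N ∧
      (l.map (finConj S)).prod = Finset.univ := by
  constructor
  · rintro ⟨n, hn, hnN, g, hg⟩
    refine ⟨List.ofFn g, by simpa using hn, by simpa using hnN, ?_⟩
    rw [← hg, List.map_ofFn]
    rfl
  · rintro ⟨l, hl, hlN, h⟩
    refine ⟨l.length, hl, hlN, l.get, ?_⟩
    have hmap : List.ofFn (fun i => finConj S (l.get i)) = (List.ofFn l.get).map (finConj S) :=
      (List.map_ofFn (f := l.get) (g := finConj S)).symm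
    rw [hmap, List.ofFn_get, h]

theorem IsProdOfConj.mono {G : Type*} [Group G] [Fintype G] [DecidableEq G]
    {S : Finset G} {M N : ℕ} (h : IsProdOfConj S M) (hMN : M ≤ N) : IsProdOfConj S N := by
  obtain ⟨n, hn, hnM, hg⟩ := h
  exact ⟨n, hn, hnM.trans hMN, hg⟩

theorem isProdOfConj_univ {G : Type*} [Group G] [Fintype G] [DecidableEq G]
    {N : ℕ} (hN : 0 < N) : IsProdOfConj (Finset.univ : Finset G) N :=
  isProdOfConj_iff_exists_list.2 ⟨[1], by simp, hN, by simp [finConj]⟩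

theorem IsProdOfConj.of_mul_finConj {G : Type*} [Group G] [Fintype G] [DecidableEq G]
    {S : Finset G} {g : G} {N : ℕ} (h : IsProdOfConj (S * finConj S g) N) :
    IsProdOfConj S (2 * N) := by
  obtain ⟨l, hl, hlN, hprod⟩ := isProdOfConj_iff_exists_list.1 h
  have key : ∀ l : List G, (l.flatMap fun h => [h, g * h]).length = 2 * l.length ∧
      ((l.flatMap fun h => [h, g * h]).map (finConj S)).prod =
        (l.map (finConj (S * finConj S g))).prod := by
    intro l
    induction l with
    | nil => simp
    | cons a l ih =>
      refine ⟨?_, ?_⟩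
      · rw [List.flatMap_cons, List.length_append, ih.1]
        simp only [List.length_cons, List.length_nil]
        ring
      · rw [List.flatMap_cons, List.map_append, List.prod_append, ih.2]
        simp [finConj_mul_finConj]
  exact isProdOfConj_iff_exists_list.2 ⟨_, by rw [(key l).1]; omega, by rw [(key l).1]; omega,
    (key l).2.trans hprod⟩

/-- If every set either grows by an exponent `1 + τ` on multiplication by a conjugate or has `b`
conjugates with product `G`, then a set `S` with `|G| ≤ |S| ^ ((1 + τ) ^ k)` has at most `2 ^ k * b`
conjugates with product `G`. -/
theorem isProdOfConj_of_card_le_rpow {G : Type*} [Group G] [Fintype G] [DecidableEq G]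
    {τ : ℝ} (hτ : 0 < τ) {b : ℕ} (hb : 0 < b)
    (hG : ∀ S : Finset G, 2 ≤ S.card →
      (∃ g : G, ((S * finConj S g).card : ℝ) ≥ (S.card : ℝ) ^ ((1 : ℝ) + τ)) ∨
        IsProdOfConj S b)
    (k : ℕ) (S : Finset G) (hS : 2 ≤ S.card)
    (hcard : (Fintype.card G : ℝ) ≤ (S.card : ℝ) ^ ((1 + τ) ^ k)) :
    IsProdOfConj S (2 ^ k * b) := by
  induction k generalizing S with
  | zero =>
    have h : Fintype.card G ≤ S.card := by simpa using hcard
    have hu : S = Finset.univ :=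
      (Finset.card_eq_iff_eq_univ S).1 (le_antisymm (Finset.card_le_univ S) h)
    rw [hu]
    exact isProdOfConj_univ (by simpa using hb)
  | succ k ih =>
    rcases hG S hS with ⟨g, hg⟩ | h
    · have h1 : (1 : ℝ) ≤ S.card := by exact_mod_cast (by omega : 1 ≤ S.card)
      have h2 : (S.card : ℝ) ≤ (S * finConj S g).card :=
        (Real.self_le_rpow_of_one_le h1 (by linarith)).trans hg
      rw [pow_succ', mul_assoc]
      refine (ih _ (hS.trans (by exact_mod_cast h2)) (hcard.trans ?_)).of_mul_finConj
      rw [pow_succ', Real.rpow_mul (by positivity)]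
      exact Real.rpow_le_rpow (by positivity) hg (by positivity)
    · exact h.mono (Nat.le_mul_of_pos_left b (by positivity))

theorem stmt_13 {G : Type*} [Group G] [Fintype G] [DecidableEq G] [Nontrivial G]
    (τ : ℝ) (hτ : 0 < τ) (b : ℕ) (hb : 0 < b)
    (hG : ∀ S : Finset G, 2 ≤ S.card →
      (∃ g : G, ((S * finConj S g).card : ℝ) ≥ (S.card : ℝ) ^ ((1 : ℝ) + τ)) ∨
        IsProdOfConj S b) :
    ∀ c : ℝ, 0 < c → c ≤ 1 → ∀ Y : Finset G, 2 ≤ Y.card →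
      (Y.card : ℝ) ≥ (Fintype.card G : ℝ) ^ c →
      IsProdOfConj Y (2 ^ ⌈Real.log (1 / c) / Real.log (1 + τ)⌉₊ * b) := by
  intro c hc _ Y hY hcard
  refine isProdOfConj_of_card_le_rpow hτ hb hG _ Y hY ?_
  set k := ⌈Real.log (1 / c) / Real.log (1 + τ)⌉₊ with hk
  have hlog : 0 < Real.log (1 + τ) := Real.log_pos (by linarith)
  have hpow : 1 / c ≤ (1 + τ) ^ k := by
    rw [← Real.log_le_log_iff (by positivity) (by positivity), Real.log_pow,
      ← div_le_iff₀ hlog]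
    exact Nat.le_ceil _
  have hone : 1 ≤ c * (1 + τ) ^ k := by
    rwa [div_le_iff₀' hc] at hpow
  have hcardG : (1 : ℝ) ≤ Fintype.card G := by exact_mod_cast Fintype.card_pos
  calc (Fintype.card G : ℝ) ≤ (Fintype.card G : ℝ) ^ (c * (1 + τ) ^ k) :=
        Real.self_le_rpow_of_one_le hcardG hone
    _ = ((Fintype.card G : ℝ) ^ c) ^ ((1 + τ) ^ k) := Real.rpow_mul (by positivity) _ _
    _ ≤ (Y.card : ℝ) ^ ((1 + τ) ^ k) := Real.rpow_le_rpow (by positivity) hcard (by positivity)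
end
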